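/- For a linear pentapod design with planar base, the map w ↦ det S(u,v,w,p_x,p_y,p_z) is affine for every fixed (u,v,p_x,p_y,p_z) (i.e., the coefficient of w² in det S vanishes for all positions) if and only if [r,Y,rX,rY] = 0 and [r,X,rX,rY] = 0. -/

import Mathlib

open Matrix

/-- The 7×7 matrix `S` of a linear pentapod design with platform parameters
`r` and base coordinates `x`, `y`, `z` (indices `1,…,4` of `Fin 5` correspond to
legs `2,…,5`; index `0` corresponds to leg `1`), at pose `(u,v,w,px,py,pz)`. -/
noncomputable def Smat (r x y z : Fin 5 → ℝ) (u v w px py pz : ℝ) :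
    Matrix (Fin 7) (Fin 7) ℝ :=
  !![(1 : ℝ), u, v, w, px, py, pz;
     0, px, py, pz, 0, 0, 0;
     0, 0, 0, 0, u, v, w;
     r 1, x 1, y 1, z 1, r 1 * x 1, r 1 * y 1, r 1 * z 1;
     r 2, x 2, y 2, z 2, r 2 * x 2, r 2 * y 2, r 2 * z 2;
     r 3, x 3, y 3, z 3, r 3 * x 3, r 3 * y 3, r 3 * z 3;
     r 4, x 4, y 4, z 4, r 4 * x 4, r 4 * y 4, r 4 * z 4]

/-- The 4×7 architecture matrix of the design. -/
noncomputable def archMat (r x y z : Fin 5 → ℝ) : Matrix (Fin 4) (Fin 7) ℝ :=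
  !![r 1, x 1, y 1, z 1, r 1 * x 1, r 1 * y 1, r 1 * z 1;
     r 2, x 2, y 2, z 2, r 2 * x 2, r 2 * y 2, r 2 * z 2;
     r 3, x 3, y 3, z 3, r 3 * x 3, r 3 * y 3, r 3 * z 3;
     r 4, x 4, y 4, z 4, r 4 * x 4, r 4 * y 4, r 4 * z 4]

/-- The design is architecturally singular: the singularity polynomial `det S`
vanishes at every pose on the quadric `u² + v² + w² = 1`. -/
def ArchSingular (r x y z : Fin 5 → ℝ) : Prop :=
  ∀ u v w px py pz : ℝ, u ^ 2 + v ^ 2 + w ^ 2 = 1 →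
    (Smat r x y z u v w px py pz).det = 0

/-- The bracket `[A₁, A₂, A₃, A₄]`: the determinant of the 4×4 matrix with
columns `A₁, A₂, A₃, A₄`. -/
noncomputable def bracket (A1 A2 A3 A4 : Fin 4 → ℝ) : ℝ :=
  (Matrix.of fun i j => ![A1, A2, A3, A4] j i).det

/-- The vector in `ℝ⁴` formed by the values of `f` at legs `2,…,5`. -/
def colVec (f : Fin 5 → ℝ) : Fin 4 → ℝ := fun i => f i.succ

/-- The componentwise product vector (e.g. `rX`, `rY`, `rZ`) for legs `2,…,5`. -/
def colProd (r f : Fin 5 → ℝ) : Fin 4 → ℝ := fun i => r i.succ * f i.succ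

/-- The base anchor point `M_j = (x_j, y_j, z_j) ∈ ℝ³`. -/
def Mpt (x y z : Fin 5 → ℝ) (j : Fin 5) : Fin 3 → ℝ := ![x j, y j, z j]

/-- The 5×5 minor of `S` obtained by deleting the two columns of `z`-type together with two of the
first three rows; `a, b, c, d, e` are the entries of the remaining pose row. -/
noncomputable def planarMinor (r x y : Fin 5 → ℝ) (a b c d e : ℝ) : Matrix (Fin 5) (Fin 5) ℝ :=
  !![a, b, c, d, e;
     r 1, x 1, y 1, r 1 * x 1, r 1 * y 1;
     r 2, x 2, y 2, r 2 * x 2, r 2 * y 2;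
     r 3, x 3, y 3, r 3 * x 3, r 3 * y 3;
     r 4, x 4, y 4, r 4 * x 4, r 4 * y 4]

theorem det_planarMinor_position (r x y : Fin 5 → ℝ) (px py : ℝ) :
    (planarMinor r x y 0 px py 0 0).det =
      py * bracket (colVec r) (colVec x) (colProd r x) (colProd r y) -
        px * bracket (colVec r) (colVec y) (colProd r x) (colProd r y) := by
  simp [planarMinor, bracket, colVec, colProd, det_succ_row_zero, Fin.sum_univ_succ,
    Fin.succAbove]
  ring

/-- A 6×6 matrix with two free rows, completed by the rows of a planar design. -/
noncomputable def planarMinorSix (r x y : Fin 5 → ℝ) (p q : Fin 6 → ℝ) :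
    Matrix (Fin 6) (Fin 6) ℝ :=
  !![p 0, p 1, p 2, p 3, p 4, p 5;
     q 0, q 1, q 2, q 3, q 4, q 5;
     r 1, x 1, y 1, r 1 * x 1, r 1 * y 1, 0;
     r 2, x 2, y 2, r 2 * x 2, r 2 * y 2, 0;
     r 3, x 3, y 3, r 3 * x 3, r 3 * y 3, 0;
     r 4, x 4, y 4, r 4 * x 4, r 4 * y 4, 0]

theorem det_planarMinorSix (r x y : Fin 5 → ℝ) (p q : Fin 6 → ℝ) :
    (planarMinorSix r x y p q).det =
      q 5 * (planarMinor r x y (p 0) (p 1) (p 2) (p 3) (p 4)).det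
        - p 5 * (planarMinor r x y (q 0) (q 1) (q 2) (q 3) (q 4)).det := by
  have h0 : (planarMinorSix r x y p q).submatrix (Fin.succAbove 0) (Fin.succAbove 5) =
      planarMinor r x y (q 0) (q 1) (q 2) (q 3) (q 4) := by
    ext i j
    fin_cases i <;> fin_cases j <;> rfl
  have h1 : (planarMinorSix r x y p q).submatrix (Fin.succAbove 1) (Fin.succAbove 5) =
      planarMinor r x y (p 0) (p 1) (p 2) (p 3) (p 4) := by
    ext i j
    fin_cases i <;> fin_cases j <;> rfl
  rw [det_succ_column _ 5, Fin.sum_univ_six, h0, h1]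
  have e0 : planarMinorSix r x y p q 0 5 = p 5 := rfl
  have e1 : planarMinorSix r x y p q 1 5 = q 5 := rfl
  have e2 : planarMinorSix r x y p q 2 5 = 0 := rfl
  have e3 : planarMinorSix r x y p q 3 5 = 0 := rfl
  have e4 : planarMinorSix r x y p q 4 5 = 0 := rfl
  have e5 : planarMinorSix r x y p q 5 5 = 0 := rfl
  rw [e0, e1, e2, e3, e4, e5]
  norm_num [pow_succ]
  ring

/-- Laplace expansion of `det S` along the fourth and seventh columns for a planar base. -/
theorem det_Smat_of_planar (r x y z : Fin 5 → ℝ) (hz : ∀ j, z j = 0) (u v w px py pz : ℝ) :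
    (Smat r x y z u v w px py pz).det =
      -w ^ 2 * (planarMinor r x y 0 px py 0 0).det
        + w * pz * (planarMinor r x y 1 u v px py).det
        - pz ^ 2 * (planarMinor r x y 0 0 0 u v).det := by
  obtain rfl : z = 0 := funext hz
  have h0 : (Smat r x y 0 u v w px py pz).submatrix (Fin.succAbove 0) (Fin.succAbove 3) =
      planarMinorSix r x y ![0, px, py, 0, 0, 0] ![0, 0, 0, u, v, w] := by
    ext i j
    fin_cases i <;> fin_cases j <;>
      first | rfl | exact mul_zero _
  have h1 : (Smat r x y 0 u v w px py pz).submatrix (Fin.succAbove 1) (Fin.succAbove 3) =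
      planarMinorSix r x y ![1, u, v, px, py, pz] ![0, 0, 0, u, v, w] := by
    ext i j
    fin_cases i <;> fin_cases j <;>
      first | rfl | exact mul_zero _
  rw [det_succ_column _ 3, Fin.sum_univ_seven, h0, h1, det_planarMinorSix, det_planarMinorSix]
  have e0 : Smat r x y 0 u v w px py pz 0 3 = w := rfl
  have e1 : Smat r x y 0 u v w px py pz 1 3 = pz := rfl
  have e2 : Smat r x y 0 u v w px py pz 2 3 = 0 := rfl
  have e3 : Smat r x y 0 u v w px py pz 3 3 = 0 := rfl
  have e4 : Smat r x y 0 u v w px py pz 4 3 = 0 := rfl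
  have e5 : Smat r x y 0 u v w px py pz 5 3 = 0 := rfl
  have e6 : Smat r x y 0 u v w px py pz 6 3 = 0 := rfl
  rw [e0, e1, e2, e3, e4, e5, e6]
  simp [pow_succ]
  ring

theorem stmt11 (r x y z : Fin 5 → ℝ)
    (hr1 : r 0 = 0) (hx1 : x 0 = 0) (hy1 : y 0 = 0) (hz1 : z 0 = 0)
    (hplanar : ∀ j, z j = 0) :
    (∀ u v px py pz : ℝ, ∃ a b : ℝ, ∀ w : ℝ,
        (Smat r x y z u v w px py pz).det = a * w + b) ↔
      (bracket (colVec r) (colVec y) (colProd r x) (colProd r y) = 0 ∧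
        bracket (colVec r) (colVec x) (colProd r x) (colProd r y) = 0) := by
  simp only [det_Smat_of_planar r x y z hplanar, det_planarMinor_position]
  set B := bracket (colVec r) (colVec y) (colProd r x) (colProd r y)
  set C := bracket (colVec r) (colVec x) (colProd r x) (colProd r y)
  constructor
  · intro h
    constructor
    · obtain ⟨a, b, h⟩ := h 0 0 1 0 0
      linarith [h 0, h 1, h (-1)]
    · obtain ⟨a, b, h⟩ := h 0 0 0 1 0
      linarith [h 0, h 1, h (-1)]
  · rintro ⟨hB, hC⟩ u v px py pz
    refine ⟨pz * (planarMinor r x y 1 u v px py).det,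
      -(pz ^ 2 * (planarMinor r x y 0 0 0 u v).det), fun w => ?_⟩
    rw [hB, hC]
    ring
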